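/- For all integers d and e, there exists a 2×2 integer matrix P with det(P) = 1 such that, writing M for the matrix with rows (d, e) and (e−1, 0), the matrix Pᵀ·M·P has (1,2)-entry equal to 1 − e, (2,1)-entry equal to −e, and (2,2)-entry equal to 0; that is, Pᵀ·M·P = [[d', 1−e],[−e, 0]] for some integer d'. -/

import Mathlib

/-- For all integers `d e`, there is a unimodular `P` (with `det P = 1`) such
that `Pᵀ·M·P = !![d', 1−e; −e, 0]` for some integer `d'`, where
`M = !![d, e; e−1, 0]`. -/
theorem exists_change_of_basis (d e : ℤ) :
    ∃ P : Matrix (Fin 2) (Fin 2) ℤ, P.det = 1 ∧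
      ∃ d' : ℤ, P.transpose * !![d, e; e - 1, 0] * P = !![d', 1 - e; -e, 0] := by
  have hb := Int.gcd_eq_gcd_ab d (2 * e - 1)
  obtain ⟨k, hk⟩ := Int.gcd_dvd_left d (2 * e - 1)
  obtain ⟨m, hm⟩ := Int.gcd_dvd_right d (2 * e - 1)
  generalize Int.gcdA d (2 * e - 1) = s at hb
  generalize Int.gcdB d (2 * e - 1) = t at hb
  generalize ((Int.gcd d (2 * e - 1) : ℕ) : ℤ) = g at hb hk hm
  have hg : g ≠ 0 := by
    rintro rfl
    omega
  have h1 : k * s + m * t = 1 := by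
    apply mul_left_cancel₀ hg
    linear_combination -hb - s * hk - t * hm
  have h2 : d * m = (2 * e - 1) * k := by
    linear_combination m * hk - k * hm
  refine ⟨!![-s, m; -t, -k], ?_, d * s * s + (2 * e - 1) * s * t, ?_⟩
  · rw [Matrix.det_fin_two_of]
    linear_combination h1
  · ext i j
    fin_cases i <;> fin_cases j <;>
      simp [Matrix.mul_apply, Fin.sum_univ_two]
    · ring
    · linear_combination (-s) * h2 + (1 - e) * h1
    · linear_combination (-s) * h2 - e * h1
    · linear_combination m * h2
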